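/- Let x, y in R^N be jointly zero-mean Gaussian with covariance matrices C_x, C_y satisfying ‖C_x‖₂ ≤ λ_max and ‖C_y‖₂ ≤ λ_max, and let Q be a real N×N matrix with ‖Q‖₂ ≤ λ'_max. Then for q = y^T Q x and any ν with 0 < ν < 1/2, P(|q - E[q]| ≥ N ν) ≤ 2 exp(- N ν^2 / (8 max{λ'^2_max λ_max^2, 1})). -/

import Mathlib

open MeasureTheory ProbabilityTheory Matrix

/-- Spectral (ℓ₂ operator) norm of a matrix. -/
noncomputable def specNorm {𝕜 : Type*} [RCLike 𝕜] {m n : Type*} [Fintype m] [Fintype n]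
    [DecidableEq n] (A : Matrix m n 𝕜) : ℝ :=
  ‖LinearMap.toContinuousLinearMap (Matrix.toEuclideanLin A)‖

lemma exp_neg_div_sqrt_le {a : ℝ} (ha : |a| ≤ 1 / 4) :
    Real.exp (-a) / √(1 - 2 * a) ≤ Real.exp (2 * a ^ 2) := by
  obtain ⟨ha1, ha2⟩ := abs_le.mp ha
  have hpos : 0 < 1 - 2 * a := by linarith
  rw [div_le_iff₀ (Real.sqrt_pos.mpr hpos), ← div_le_iff₀' (Real.exp_pos _), ← Real.exp_sub]
  apply Real.le_sqrt_of_sq_le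
  rw [← Real.exp_nat_mul]
  have key : 1 ≤ (1 - 2 * a) * Real.exp (2 * a + 4 * a ^ 2) := by
    rcases le_total a 0 with h | h
    · have h1 := Real.add_one_le_exp (2 * a + 4 * a ^ 2)
      nlinarith [mul_le_mul_of_nonneg_left h1 hpos.le, mul_nonneg (neg_nonneg.mpr h) (sq_nonneg a)]
    · have h1 := Real.quadratic_le_exp_of_nonneg (x := 2 * a + 4 * a ^ 2) (by positivity)
      have h2 := mul_le_mul_of_nonneg_left h1 hpos.le
      have h3 : 0 ≤ (1 - 4 * a ^ 2) * (1 + 2 * a) - 4 * a := by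
        nlinarith [mul_nonneg h (sub_nonneg.mpr ha2), mul_nonneg (sq_nonneg a) (sub_nonneg.mpr ha2)]
      nlinarith [mul_nonneg (sq_nonneg a) h3]
  calc Real.exp (((2 : ℕ) : ℝ) * (-a - 2 * a ^ 2))
      = 1 * Real.exp (-(2 * a + 4 * a ^ 2)) := by rw [one_mul]; congr 1; push_cast; ring
    _ ≤ (1 - 2 * a) * Real.exp (2 * a + 4 * a ^ 2) * Real.exp (-(2 * a + 4 * a ^ 2)) := by gcongr
    _ = 1 - 2 * a := by rw [mul_assoc, ← Real.exp_add]; simp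

lemma gaussianPDFReal_smul_exp_sq (a x : ℝ) :
    gaussianPDFReal 0 1 x • Real.exp (a * (x ^ 2 - 1)) =
      (√(2 * Real.pi))⁻¹ * Real.exp (-a) * Real.exp (-(1 / 2 - a) * x ^ 2) := by
  simp only [gaussianPDFReal, smul_eq_mul, NNReal.coe_one, mul_one, sub_zero]
  rw [mul_assoc, mul_assoc, ← Real.exp_add, ← Real.exp_add]
  congr 2
  ring

lemma integrable_exp_sq_sub_one_gaussianReal {a : ℝ} (ha : a < 1 / 2) :
    Integrable (fun x : ℝ => Real.exp (a * (x ^ 2 - 1))) (gaussianReal 0 1) := by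
  rw [gaussianReal_of_var_ne_zero _ one_ne_zero, gaussianPDF_def,
    integrable_withDensity_iff_integrable_smul₀' (by fun_prop) (by simp)]
  simp only [ENNReal.toReal_ofReal (gaussianPDFReal_nonneg 0 1 _), gaussianPDFReal_smul_exp_sq]
  exact (integrable_exp_neg_mul_sq (by linarith)).const_mul _

lemma integral_exp_sq_sub_one_gaussianReal_le {a : ℝ} (ha : |a| ≤ 1 / 4) :
    ∫ x, Real.exp (a * (x ^ 2 - 1)) ∂(gaussianReal 0 1) ≤ Real.exp (2 * a ^ 2) := by
  obtain ⟨-, ha2⟩ := abs_le.mp ha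
  have hpos : 0 < 1 - 2 * a := by linarith
  rw [integral_gaussianReal_eq_integral_smul one_ne_zero]
  simp only [gaussianPDFReal_smul_exp_sq]
  rw [integral_const_mul, integral_gaussian]
  refine le_of_eq_of_le ?_ (exp_neg_div_sqrt_le ha)
  have : Real.pi / (1 / 2 - a) = 2 * Real.pi / (1 - 2 * a) := by
    rw [div_eq_div_iff (by linarith) hpos.ne']; ring
  rw [this, Real.sqrt_div (by positivity)]
  have := Real.sqrt_pos.mpr (show 0 < 2 * Real.pi by positivity)
  field_simp

/-- Upper tail bound for a centred weighted sum of squares of independent standard Gaussians. -/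
lemma measure_sum_mul_sq_sub_one_ge_le {ι : Type*} [Fintype ι] (μ : ι → ℝ) {D n ν : ℝ}
    (hD : 1 ≤ D) (hμ : ∀ k, μ k ^ 2 ≤ D) (hsum : ∑ k, μ k ^ 2 ≤ n * D)
    (hν0 : 0 < ν) (hν : ν < 1 / 2) :
    (Measure.pi fun _ : ι => gaussianReal 0 1).real
        {g | n * ν ≤ ∑ k, μ k * (g k ^ 2 - 1)} ≤ Real.exp (-(n * ν ^ 2) / (8 * D)) := by
  have hD0 : 0 < D := by linarith
  set s : ℝ := ν / (4 * D) with hs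
  have hs0 : 0 ≤ s := by positivity
  have hsD : s * D = ν / 4 := by rw [hs]; field_simp
  have hsμ (k) : |s * μ k| ≤ 1 / 4 := by
    apply abs_le_of_sq_le_sq _ (by norm_num)
    calc (s * μ k) ^ 2 = s ^ 2 * μ k ^ 2 := by ring
      _ ≤ s ^ 2 * D ^ 2 := 
          mul_le_mul_of_nonneg_left (by nlinarith [hμ k]) (sq_nonneg s)
      _ = (ν / 4) ^ 2 := by rw [← hsD]; ring
      _ ≤ (1 / 4) ^ 2 := by gcongr; linarith
  have hexp (g : ι → ℝ) : Real.exp (s * ∑ k, μ k * (g k ^ 2 - 1)) =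
      ∏ k, Real.exp (s * μ k * (g k ^ 2 - 1)) := by
    rw [← Real.exp_sum, Finset.mul_sum]; simp only [mul_assoc]
  have h_int : Integrable (fun g : ι → ℝ => Real.exp (s * ∑ k, μ k * (g k ^ 2 - 1)))
      (Measure.pi fun _ : ι => gaussianReal 0 1) := by
    simp only [hexp]
    exact Integrable.fintype_prod (f := fun k x => Real.exp (s * μ k * (x ^ 2 - 1))) fun k =>
      integrable_exp_sq_sub_one_gaussianReal (by linarith [(abs_le.mp (hsμ k)).2])
  refine (measure_ge_le_exp_mul_mgf (n * ν) hs0 h_int).trans ?_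
  have hmgf : mgf (fun g : ι → ℝ => ∑ k, μ k * (g k ^ 2 - 1))
      (Measure.pi fun _ : ι => gaussianReal 0 1) s ≤ Real.exp (2 * s ^ 2 * (n * D)) := by
    simp only [mgf, hexp]
    rw [integral_fintype_prod_eq_prod (f := fun k x => Real.exp (s * μ k * (x ^ 2 - 1)))]
    calc _ ≤ ∏ k, Real.exp (2 * (s * μ k) ^ 2) :=
          Finset.prod_le_prod (fun k _ => integral_nonneg fun x => (Real.exp_pos _).le)
            fun k _ => integral_exp_sq_sub_one_gaussianReal_le (hsμ k)
      _ = Real.exp (2 * s ^ 2 * ∑ k, μ k ^ 2) := by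
          rw [← Real.exp_sum, Finset.mul_sum]; congr 1
          exact Finset.sum_congr rfl fun k _ => by ring
      _ ≤ _ := by gcongr
  calc _ ≤ Real.exp (-s * (n * ν)) * Real.exp (2 * s ^ 2 * (n * D)) := by gcongr
    _ = _ := by
      rw [← Real.exp_add]; congr 1; rw [hs]; field_simp; ring

lemma abs_dotProduct_mulVec_le {m n : Type*} [Fintype m] [Fintype n] [DecidableEq n]
    (A : Matrix m n ℝ) (v : m → ℝ) (w : n → ℝ) :
    |v ⬝ᵥ A *ᵥ w| ≤ ‖WithLp.toLp 2 v‖ * (specNorm A * ‖WithLp.toLp 2 w‖) := by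
  have h := abs_real_inner_le_norm (WithLp.toLp 2 v) (WithLp.toLp 2 (A *ᵥ w))
  have h2 := (LinearMap.toContinuousLinearMap (Matrix.toEuclideanLin A)).le_opNorm
    (WithLp.toLp 2 w)
  rw [EuclideanSpace.inner_toLp_toLp, dotProduct_comm] at h
  exact h.trans (mul_le_mul_of_nonneg_left h2 (norm_nonneg _))

lemma norm_col_sq_le {m n : Type*} [Fintype m] [Fintype n] [DecidableEq m]
    (X : Matrix m n ℝ) {c : ℝ} (hX : specNorm (X * Xᵀ) ≤ c) (k : n) :
    ‖WithLp.toLp 2 (X.col k)‖ ^ 2 ≤ c := by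
  have hc : 0 ≤ c := (norm_nonneg _).trans hX
  have hn : ‖WithLp.toLp 2 (X.col k)‖ ^ 2 = X.col k ⬝ᵥ X.col k := by
    rw [EuclideanSpace.real_norm_sq_eq]; simp [dotProduct, pow_two]
  have h1 : X.col k ⬝ᵥ (X * Xᵀ) *ᵥ X.col k = ∑ j, (X.col j ⬝ᵥ X.col k) ^ 2 := by
    rw [← mulVec_mulVec, dotProduct_mulVec, ← mulVec_transpose]
    simp [dotProduct, mulVec, pow_two]
  have h2 : (X.col k ⬝ᵥ X.col k) ^ 2 ≤ ∑ j, (X.col j ⬝ᵥ X.col k) ^ 2 :=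
    Finset.single_le_sum (f := fun j => (X.col j ⬝ᵥ X.col k) ^ 2)
      (fun j _ => sq_nonneg _) (Finset.mem_univ k)
  have h3 := (le_abs_self _).trans (abs_dotProduct_mulVec_le (X * Xᵀ) (X.col k) (X.col k))
  rw [h1] at h3
  rw [← hn] at h2
  by_contra! hlt
  have h4 : ‖WithLp.toLp 2 (X.col k)‖ * (specNorm (X * Xᵀ) * ‖WithLp.toLp 2 (X.col k)‖) ≤
      c * ‖WithLp.toLp 2 (X.col k)‖ ^ 2 := by
    nlinarith [mul_le_mul_of_nonneg_right hX (sq_nonneg ‖WithLp.toLp 2 (X.col k)‖)]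
  nlinarith

lemma sum_norm_col_sq_le {m n : Type*} [Fintype m] [Fintype n] [DecidableEq m]
    (X : Matrix m n ℝ) {c : ℝ} (hX : specNorm (X * Xᵀ) ≤ c) :
    ∑ k, ‖WithLp.toLp 2 (X.col k)‖ ^ 2 ≤ Fintype.card m * c := by
  have h : ∑ k, ‖WithLp.toLp 2 (X.col k)‖ ^ 2 = ∑ i, (X * Xᵀ) i i := by
    simp_rw [EuclideanSpace.real_norm_sq_eq, mul_apply, transpose_apply, ← pow_two]
    exact Finset.sum_comm
  rw [h, ← Finset.card_univ, ← nsmul_eq_mul, ← Finset.sum_const]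
  refine Finset.sum_le_sum fun i _ => ?_
  have := (le_abs_self _).trans
    (abs_dotProduct_mulVec_le (X * Xᵀ) (Pi.single i 1) (Pi.single i 1))
  rw [mulVec_single_one, single_one_dotProduct] at this
  simpa using this.trans (by simpa using hX)

open scoped MatrixOrder Matrix.Norms.L2Operator in
/-- Simultaneous reduction of a covariance matrix and a quadratic form. -/
lemma exists_mul_transpose_eq_and_diagonal {ι : Type*} [Fintype ι] [DecidableEq ι]
    {C A : Matrix ι ι ℝ} (hC : C.PosSemidef) (hA : A.IsSymm) :
    ∃ (W : Matrix ι ι ℝ) (μ : ι → ℝ), W * Wᵀ = C ∧ Wᵀ * A * W = diagonal μ := by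
  obtain ⟨B, rfl⟩ := CStarAlgebra.nonneg_iff_eq_star_mul_self.mp hC.nonneg
  rw [star_eq_conjTranspose, conjTranspose_eq_transpose_of_trivial]
  have hM : (B * A * Bᵀ).IsHermitian := by
    rw [IsHermitian, conjTranspose_eq_transpose_of_trivial]
    simp [transpose_mul, hA.eq, Matrix.mul_assoc]
  set U : Matrix ι ι ℝ := hM.eigenvectorUnitary.1 with hU
  have hU1 : U * Uᵀ = 1 := by
    have := mem_unitaryGroup_iff.mp hM.eigenvectorUnitary.2
    rwa [star_eq_conjTranspose, conjTranspose_eq_transpose_of_trivial] at this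
  have hU2 : Uᵀ * U = 1 := by
    have := mem_unitaryGroup_iff'.mp hM.eigenvectorUnitary.2
    rwa [star_eq_conjTranspose, conjTranspose_eq_transpose_of_trivial] at this
  refine ⟨Bᵀ * U, hM.eigenvalues, ?_, ?_⟩
  · rw [transpose_mul, transpose_transpose, Matrix.mul_assoc, ← Matrix.mul_assoc U, hU1,
      Matrix.one_mul]
  · have h := hM.spectral_theorem
    rw [Unitary.conjStarAlgAut_apply, star_eq_conjTranspose,
      conjTranspose_eq_transpose_of_trivial] at h
    have : (Bᵀ * U)ᵀ * A * (Bᵀ * U) = Uᵀ * (B * A * Bᵀ) * U := by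
      simp [transpose_mul, Matrix.mul_assoc]
    rw [this]
    refine (congrArg (fun T => Uᵀ * T * U) h).trans ?_
    rw [← hU, Matrix.mul_assoc, Matrix.mul_assoc, Matrix.mul_assoc, hU2, Matrix.mul_one,
      ← Matrix.mul_assoc, hU2, Matrix.one_mul]
    rfl

/-- A centred Gaussian vector with covariance `W Wᵀ` has the law of `W g`, `g` standard. -/
lemma map_eq_map_mulVec_pi_gaussianReal {Ω ι : Type*} [MeasurableSpace Ω] {P : Measure Ω}
    [IsProbabilityMeasure P] [Fintype ι] [DecidableEq ι] {z : ι → Ω → ℝ} (hmeas : ∀ i, Measurable (z i))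
    (W : Matrix ι ι ℝ)
    (hgauss : ∀ u : ι → ℝ, P.map (fun ω => ∑ i, u i * z i ω) =
      gaussianReal 0 (Real.toNNReal (∑ i, ∑ j, u i * (W * Wᵀ) i j * u j))) :
    P.map (fun ω i => z i ω) =
      (Measure.pi fun _ : ι => gaussianReal 0 1).map (fun g => W *ᵥ g) := by
  have hz : Measurable (fun ω i => z i ω) := measurable_pi_lambda _ hmeas
  have hW : Measurable (fun g : ι → ℝ => W *ᵥ g) := by fun_prop
  have : IsProbabilityMeasure (P.map (fun ω i => z i ω)) :=
    Measure.isProbabilityMeasure_map hz.aemeasurable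
  have : IsProbabilityMeasure ((Measure.pi fun _ : ι => gaussianReal 0 1).map
    (fun g => W *ᵥ g)) := Measure.isProbabilityMeasure_map hW.aemeasurable
  apply Measure.ext_of_charFunDual
  ext L
  set u : ι → ℝ := fun i => L (Pi.single i 1) with hu
  have hL (x : ι → ℝ) : L x = ∑ i, u i * x i := by
    have := LinearMap.pi_apply_eq_sum_univ L.toLinearMap x
    simp only [ContinuousLinearMap.coe_coe, smul_eq_mul] at this
    rw [this]
    refine Finset.sum_congr rfl fun i _ => ?_
    rw [mul_comm, hu]
    congr 2
    ext j
    simp [Pi.single_apply, eq_comm]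
  set v : ι → ℝ := u ᵥ* W with hv
  have hquad : ∑ i, ∑ j, u i * (W * Wᵀ) i j * u j = ∑ k, v k ^ 2 := by
    have h1 : ∑ i, ∑ j, u i * (W * Wᵀ) i j * u j = u ⬝ᵥ (W * Wᵀ) *ᵥ u := by
      simp [dotProduct, mulVec, Finset.mul_sum, mul_assoc]
    rw [h1, ← mulVec_mulVec, dotProduct_mulVec, mulVec_transpose]
    simp [dotProduct, hv, pow_two]
  have hLW (g : ι → ℝ) : L (W *ᵥ g) = ∑ k, v k * g k := by
    rw [hL]
    exact dotProduct_mulVec u W g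
  have h1 : charFunDual (P.map (fun ω i => z i ω)) L =
      charFun (P.map (fun ω => ∑ i, u i * z i ω)) 1 := by
    rw [charFunDual_eq_charFun_map_one, Measure.map_map (by fun_prop) hz]
    congr 2
    ext ω
    exact hL _
  rw [h1, hgauss, charFun_gaussianReal, hquad, charFunDual_apply,
    integral_map hW.aemeasurable (by fun_prop)]
  simp_rw [hLW, Complex.ofReal_sum, Finset.sum_mul, Complex.exp_sum]
  rw [integral_fintype_prod_eq_prod (f := fun k (x : ℝ) => Complex.exp (↑(v k * x) * Complex.I))]
  have h2 (k) : ∫ x : ℝ, Complex.exp (↑(v k * x) * Complex.I) ∂(gaussianReal 0 1) =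
      Complex.exp (-(v k ^ 2 : ℝ) / 2) := by
    have := charFun_gaussianReal (μ := 0) (v := 1) (v k)
    rw [charFun_apply_real] at this
    simpa [neg_div] using this
  simp_rw [h2]
  rw [← Complex.exp_sum, Real.coe_toNNReal _ (Finset.sum_nonneg fun k _ => sq_nonneg _)]
  congr 1
  simp [Finset.sum_div, neg_div]

lemma posSemidef_of_forall_eq_integral_mul {Ω ι : Type*} [MeasurableSpace Ω] {P : Measure Ω}
    [Fintype ι] {z : ι → Ω → ℝ} (hz : ∀ i, MemLp (z i) 2 P) {C : Matrix ι ι ℝ}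
    (hC : ∀ i j, C i j = ∫ ω, z i ω * z j ω ∂P) : C.PosSemidef := by
  refine PosSemidef.of_dotProduct_mulVec_nonneg ?_ fun x => ?_
  · ext i j
    simp [hC, mul_comm]
  · have h : star x ⬝ᵥ C *ᵥ x = ∫ ω, (∑ i, x i * z i ω) ^ 2 ∂P := by
      simp_rw [pow_two, Finset.sum_mul_sum]
      have h_int (i j) : Integrable (fun ω => x i * z i ω * (x j * z j ω)) P :=
        ((hz i).const_mul (x i)).integrable_mul ((hz j).const_mul (x j))
      rw [integral_finsetSum _ fun i _ => integrable_finsetSum _ fun j _ => h_int i j]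
      simp only [dotProduct, mulVec, Finset.mul_sum, hC, star_trivial]
      refine Finset.sum_congr rfl fun i _ => ?_
      rw [integral_finsetSum _ fun j _ => h_int i j]
      refine Finset.sum_congr rfl fun j _ => ?_
      rw [← integral_mul_const, ← integral_const_mul]
      congr 1
      ext ω
      ring
    rw [h]
    exact integral_nonneg fun ω => sq_nonneg _

lemma integrable_sq_gaussianReal (v : NNReal) :
    Integrable (fun x : ℝ => x ^ 2) (gaussianReal 0 v) :=
  (memLp_id_gaussianReal' 2 (by simp)).integrable_sq

lemma integral_sq_gaussianReal (v : NNReal) : ∫ x, x ^ 2 ∂(gaussianReal 0 v) = v := by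
  have := variance_fun_id_gaussianReal (μ := 0) (v := v)
  rw [variance_eq_integral measurable_id'.aemeasurable] at this
  simpa using this

/-- Two-sided deviation bound for a weighted sum of squares of independent standard Gaussians. -/
lemma measure_abs_sum_mul_sq_sub_ge_le {ι : Type*} [Fintype ι] (μ : ι → ℝ) {D n ν : ℝ}
    (hD : 1 ≤ D) (hμ : ∀ k, μ k ^ 2 ≤ D) (hsum : ∑ k, μ k ^ 2 ≤ n * D)
    (hν0 : 0 < ν) (hν : ν < 1 / 2) :
    (Measure.pi fun _ : ι => gaussianReal 0 1).real
        {g | |∑ k, μ k * g k ^ 2 - ∑ k, μ k| ≥ n * ν} ≤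
      2 * Real.exp (-(n * ν ^ 2) / (8 * D)) := by
  have h1 := measure_sum_mul_sq_sub_one_ge_le μ hD hμ hsum hν0 hν
  have h2 := measure_sum_mul_sq_sub_one_ge_le (-μ) hD (by simpa using hμ) (by simpa using hsum)
    hν0 hν
  have hsub : {g : ι → ℝ | |∑ k, μ k * g k ^ 2 - ∑ k, μ k| ≥ n * ν} ⊆
      {g | n * ν ≤ ∑ k, μ k * (g k ^ 2 - 1)} ∪ {g | n * ν ≤ ∑ k, (-μ) k * (g k ^ 2 - 1)} := by
    intro g hg
    simp only [mul_sub, mul_one, Finset.sum_sub_distrib, Pi.neg_apply, neg_mul,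
      Finset.sum_neg_distrib, Set.mem_union, Set.mem_ofPred_eq]
    rcases le_abs.mp (Set.mem_ofPred_eq ▸ hg : n * ν ≤ _) with h | h
    · exact Or.inl h
    · exact Or.inr (by linarith)
  linarith [(measureReal_mono (μ := Measure.pi fun _ : ι => gaussianReal 0 1) hsub).trans
    (measureReal_union_le _ _)]

lemma dotProduct_fromBlocks_mulVec {n : Type*} [Fintype n] (Q : Matrix n n ℝ) (v : n ⊕ n → ℝ) :
    v ⬝ᵥ ((1 / 2 : ℝ) • fromBlocks 0 Qᵀ Q 0) *ᵥ v =
      ∑ i, ∑ j, v (Sum.inr i) * Q i j * v (Sum.inl j) := by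
  have h1 : v ⬝ᵥ fromBlocks 0 Qᵀ Q 0 *ᵥ v =
      (v ∘ Sum.inl) ⬝ᵥ Qᵀ *ᵥ (v ∘ Sum.inr) + (v ∘ Sum.inr) ⬝ᵥ Q *ᵥ (v ∘ Sum.inl) := by
    rw [fromBlocks_mulVec]
    simp [dotProduct]
  have h2 : (v ∘ Sum.inl) ⬝ᵥ Qᵀ *ᵥ (v ∘ Sum.inr) = (v ∘ Sum.inr) ⬝ᵥ Q *ᵥ (v ∘ Sum.inl) := by
    rw [mulVec_transpose, dotProduct_mulVec, dotProduct_comm]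
  rw [smul_mulVec, dotProduct_smul, h1, h2, smul_eq_mul]
  simp only [dotProduct, mulVec, Finset.mul_sum, Function.comp_apply, mul_assoc]
  ring

/-- Large deviations of a bilinear Gaussian form (Lemma 7): for jointly zero-mean
Gaussian `x, y ∈ ℝ^N` with `‖C_x‖₂ ≤ λmax`, `‖C_y‖₂ ≤ λmax` and `‖Q‖₂ ≤ λ'max`,
the form `q = yᵀ Q x` satisfies
`P(|q - E q| ≥ N ν) ≤ 2 exp(-N ν² / (8 max{λ'max² λmax², 1}))` for `0 < ν < 1/2`. -/
theorem stmt_3 {Ω : Type*} [MeasurableSpace Ω] (P : Measure Ω) [IsProbabilityMeasure P]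
    (N : ℕ) (z : (Fin N ⊕ Fin N) → Ω → ℝ) (hmeas : ∀ i, Measurable (z i))
    (Cz : Matrix (Fin N ⊕ Fin N) (Fin N ⊕ Fin N) ℝ)
    (hCz : ∀ i j, Cz i j = ∫ ω, z i ω * z j ω ∂P)
    (hgauss : ∀ u : (Fin N ⊕ Fin N) → ℝ,
      Measure.map (fun ω => ∑ i, u i * z i ω) P
        = gaussianReal 0 (Real.toNNReal (∑ i, ∑ j, u i * Cz i j * u j)))
    (lammax lammax' : ℝ)
    (hCx : specNorm Cz.toBlocks₁₁ ≤ lammax) (hCy : specNorm Cz.toBlocks₂₂ ≤ lammax)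
    (Q : Matrix (Fin N) (Fin N) ℝ) (hQ : specNorm Q ≤ lammax')
    (ν : ℝ) (hν0 : 0 < ν) (hν : ν < 1/2) :
    P {ω | |(∑ i, ∑ j, z (Sum.inr i) ω * Q i j * z (Sum.inl j) ω)
            - ∫ ω', ∑ i, ∑ j, z (Sum.inr i) ω' * Q i j * z (Sum.inl j) ω' ∂P| ≥ (N : ℝ) * ν}
      ≤ ENNReal.ofReal
          (2 * Real.exp (-((N : ℝ) * ν ^ 2) / (8 * max (lammax' ^ 2 * lammax ^ 2) 1))) := by
  classical
  have hL2 (i) : MemLp (z i) 2 P := by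
    have h := hgauss (Pi.single i 1)
    have he : (fun ω => ∑ k, (Pi.single i 1 : Fin N ⊕ Fin N → ℝ) k * z k ω) = z i := by
      ext ω
      exact single_one_dotProduct i (fun k => z k ω)
    rw [he] at h
    have hid : MemLp id 2 (P.map (z i)) := h ▸ memLp_id_gaussianReal' 2 (by simp)
    exact hid.comp_of_map (hmeas i).aemeasurable
  set A : Matrix (Fin N ⊕ Fin N) (Fin N ⊕ Fin N) ℝ := (1 / 2 : ℝ) • fromBlocks 0 Qᵀ Q 0 with hA
  have hAsymm : A.IsSymm := by
    rw [IsSymm, hA, transpose_smul, fromBlocks_transpose]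
    simp
  obtain ⟨W, μ, hWC, hWA⟩ :=
    exists_mul_transpose_eq_and_diagonal (posSemidef_of_forall_eq_integral_mul hL2 hCz) hAsymm
  subst hWC
  have hlaw := map_eq_map_mulVec_pi_gaussianReal hmeas W hgauss
  set q : (Fin N ⊕ Fin N → ℝ) → ℝ := fun v => ∑ i, ∑ j, v (Sum.inr i) * Q i j * v (Sum.inl j)
    with hq
  have hqW (g) : q (W *ᵥ g) = ∑ k, μ k * g k ^ 2 := by
    rw [hq]
    beta_reduce
    rw [← dotProduct_fromBlocks_mulVec, ← hA]
    have : (W *ᵥ g) ⬝ᵥ A *ᵥ (W *ᵥ g) = g ⬝ᵥ (Wᵀ * A * W) *ᵥ g := by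
      rw [← mulVec_mulVec, ← mulVec_mulVec, dotProduct_mulVec g, vecMul_transpose]
    rw [this, hWA]
    simp only [dotProduct, mulVec_diagonal]
    exact Finset.sum_congr rfl fun k _ => by ring
  have hqm : Measurable q := by fun_prop
  have hzm : Measurable (fun ω i => z i ω) := measurable_pi_lambda _ hmeas
  have hWm : Measurable (fun g : Fin N ⊕ Fin N → ℝ => W *ᵥ g) := by fun_prop
  have hmean : ∫ ω, q (fun i => z i ω) ∂P = ∑ k, μ k := by
    rw [← integral_map (f := q) hzm.aemeasurable hqm.aestronglyMeasurable, hlaw,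
      integral_map hWm.aemeasurable hqm.aestronglyMeasurable]
    simp only [hqW]
    have h_int (k : Fin N ⊕ Fin N) : Integrable (fun g : Fin N ⊕ Fin N → ℝ => g k ^ 2)
        (Measure.pi fun _ => gaussianReal 0 1) :=
      integrable_comp_eval (i := k) (μ := fun _ => gaussianReal 0 1) (f := fun x : ℝ => x ^ 2)
        (integrable_sq_gaussianReal 1)
    rw [integral_finsetSum _ fun k _ => (h_int k).const_mul _]
    refine Finset.sum_congr rfl fun k _ => ?_
    have hsq : ∫ g : Fin N ⊕ Fin N → ℝ, g k ^ 2 ∂(Measure.pi fun _ => gaussianReal 0 1) = 1 :=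
      (integral_comp_eval (i := k) (μ := fun _ => gaussianReal 0 1) (f := fun x : ℝ => x ^ 2)
        (by fun_prop)).trans (integral_sq_gaussianReal 1)
    rw [integral_const_mul, hsq, mul_one]
  have hlam : 0 ≤ lammax := (norm_nonneg _).trans hCx
  have hlam' : 0 ≤ lammax' := (norm_nonneg _).trans hQ
  set X : Matrix (Fin N) (Fin N ⊕ Fin N) ℝ := W.submatrix Sum.inl id with hX
  set Y : Matrix (Fin N) (Fin N ⊕ Fin N) ℝ := W.submatrix Sum.inr id with hY
  have hXC : specNorm (X * Xᵀ) ≤ lammax := hCx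
  have hYC : specNorm (Y * Yᵀ) ≤ lammax := hCy
  have hμ (k) : μ k ^ 2 ≤ lammax' ^ 2 * lammax * ‖WithLp.toLp 2 (X.col k)‖ ^ 2 := by
    have h1 : μ k = Y.col k ⬝ᵥ Q *ᵥ X.col k := by
      have := hqW (Pi.single k 1)
      rw [mulVec_single_one] at this
      simp only [Pi.single_apply, ite_pow, one_pow, ne_eq, OfNat.ofNat_ne_zero, not_false_eq_true,
        zero_pow, mul_ite, mul_one, mul_zero, Finset.sum_ite_eq', Finset.mem_univ, if_true] at this
      rw [← this]
      simp [hq, dotProduct, mulVec, Finset.mul_sum, mul_assoc, hX, hY]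
    have h2 := abs_dotProduct_mulVec_le Q (Y.col k) (X.col k)
    rw [← h1] at h2
    calc μ k ^ 2 = |μ k| ^ 2 := (sq_abs _).symm
      _ ≤ (‖WithLp.toLp 2 (Y.col k)‖ * (lammax' * ‖WithLp.toLp 2 (X.col k)‖)) ^ 2 := by
        gcongr
        exact h2.trans (by gcongr)
      _ = lammax' ^ 2 * ‖WithLp.toLp 2 (Y.col k)‖ ^ 2 * ‖WithLp.toLp 2 (X.col k)‖ ^ 2 := by ring
      _ ≤ _ := by gcongr; exact norm_col_sq_le Y hYC k
  set D : ℝ := max (lammax' ^ 2 * lammax ^ 2) 1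
  have hμD (k) : μ k ^ 2 ≤ D := by
    refine (hμ k).trans (le_trans ?_ (le_max_left _ _))
    rw [pow_two lammax, ← mul_assoc]
    gcongr
    exact norm_col_sq_le X hXC k
  have hsum : ∑ k, μ k ^ 2 ≤ N * D := by
    calc ∑ k, μ k ^ 2 ≤ lammax' ^ 2 * lammax * ∑ k, ‖WithLp.toLp 2 (X.col k)‖ ^ 2 := by
          rw [Finset.mul_sum]; exact Finset.sum_le_sum fun k _ => hμ k
      _ ≤ lammax' ^ 2 * lammax * (N * lammax) := by
          gcongr
          simpa using sum_norm_col_sq_le X hXC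
      _ = N * (lammax' ^ 2 * lammax ^ 2) := by ring
      _ ≤ N * D := by gcongr; exact le_max_left _ _
  have htail := measure_abs_sum_mul_sq_sub_ge_le μ (le_max_right _ _) hμD hsum hν0 hν
  have hS : MeasurableSet {v | |q v - ∑ k, μ k| ≥ (N : ℝ) * ν} :=
    measurableSet_le measurable_const (hqm.sub_const _).abs
  change P {ω | |q (fun i => z i ω) - ∫ ω', q (fun i => z i ω') ∂P| ≥ (N : ℝ) * ν} ≤ _
  rw [hmean]
  change P ((fun ω i => z i ω) ⁻¹' {v | |q v - ∑ k, μ k| ≥ (N : ℝ) * ν}) ≤ _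
  rw [← Measure.map_apply hzm hS, hlaw, Measure.map_apply hWm hS, ← ofReal_measureReal]
  apply ENNReal.ofReal_le_ofReal
  simpa only [Set.preimage_ofPred_eq, hqW] using htail
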